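/- Let Ω ⊂ ℝ³ be a connected open set, and suppose the residual stress components t_jk, the Lamé parameters λ, μ, and the density ρ > 0 belong to the Gevrey class G^s(Ω), with T = (t_jk) symmetric, ∇·T = 0, and the operators P₁ = Σ(μδ_jk + t_jk)∂²_{jk}, P₂ = Σ((λ+2μ)δ_jk + t_jk)∂²_{jk} uniformly elliptic. If u : Ω → ℝ³ is a smooth solution of the residual stress system ∇·σ + κ²ρu = 0, then U = (u, ∇·u, ∇×u) : Ω → ℝ⁷ satisfies a fourth-order system with the same diagonal leading part: there exist 7×7-matrix-valued functions a_β ∈ G^s(Ω) for each multiindex |β| ≤ 3, depending only on λ, μ, ρ, T and κ (not on u), such that P₂P₁ U = Σ_{|β|≤3} a_β ∂^β U in Ω. -/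

import Mathlib

open MeasureTheory Metric Finset

noncomputable section

/-- `ℝ³` with the Euclidean norm. -/
abbrev E3 := EuclideanSpace ℝ (Fin 3)
/-- `ℝ⁷` with the Euclidean norm. -/
abbrev E7 := EuclideanSpace ℝ (Fin 7)

/-- The partial derivative `∂_i f`. -/
def pd (i : Fin 3) (f : E3 → ℝ) : E3 → ℝ :=
  fun x => fderiv ℝ f x (EuclideanSpace.single i 1)

/-- The multiindex partial derivative `∂^β f`. -/
def mpd (β : Fin 3 → ℕ) (f : E3 → ℝ) : E3 → ℝ :=
  (pd 0)^[β 0] ((pd 1)^[β 1] ((pd 2)^[β 2] f))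

/-- The length `|β|` of a multiindex. -/
def mdeg (β : Fin 3 → ℕ) : ℕ := β 0 + β 1 + β 2

/-- `f` belongs to the Gevrey class `G^s(Ω)`. -/
def GevreyOn (s : ℝ) (Ω : Set E3) (f : E3 → ℝ) : Prop :=
  ContDiffOn ℝ (⊤ : ℕ∞) f Ω ∧ ∃ c > 0, ∃ A > 0, ∀ β : Fin 3 → ℕ, ∀ x ∈ Ω,
    |mpd β f x| ≤ c * A ^ mdeg β * (Nat.factorial (mdeg β) : ℝ) ^ s

/-- The second-order operator `Σ_{j,k} a_jk(x) ∂²_{jk}` applied to a scalar function. -/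
def op2 (a : Fin 3 → Fin 3 → E3 → ℝ) (f : E3 → ℝ) : E3 → ℝ :=
  fun x => ∑ j, ∑ k, a j k x * pd j (pd k f) x

/-- Uniform (strong) ellipticity of `Σ_{j,k} a_jk(x) ∂²_{jk}` on `Ω`. -/
def UnifElliptic (a : Fin 3 → Fin 3 → E3 → ℝ) (Ω : Set E3) : Prop :=
  ∃ c0 > 0, ∀ x ∈ Ω, ∀ ξ : Fin 3 → ℝ,
    c0 * (∑ i, ξ i ^ 2) ≤ ∑ j, ∑ k, a j k x * ξ j * ξ k

/-- The coefficient matrix of the operator at a point. -/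
def coefMatrix (a : Fin 3 → Fin 3 → E3 → ℝ) (x : E3) : Matrix (Fin 3) (Fin 3) ℝ :=
  Matrix.of fun j k => a j k x

/-- `α > (λ₃ - λ₁)/λ₁` where `λ₁ ≤ λ₂ ≤ λ₃` are the eigenvalues of the coefficient
matrix at `0`: equivalently (the eigenvalues being positive), for any pair of
eigenvalues the corresponding ratio is `< α`. -/
def EigCond (a : Fin 3 → Fin 3 → E3 → ℝ) (α : ℝ) : Prop :=
  ∀ h : (coefMatrix a 0).IsHermitian, ∀ i j : Fin 3,
    (h.eigenvalues i - h.eigenvalues j) / h.eigenvalues j < α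

/-- The coefficients `a¹_jk = μ δ_jk + t_jk` of `P₁`. -/
def a1coef (t : Fin 3 → Fin 3 → E3 → ℝ) (mu : E3 → ℝ) : Fin 3 → Fin 3 → E3 → ℝ :=
  fun j k x => mu x * (if j = k then 1 else 0) + t j k x

/-- The coefficients `a²_jk = (λ + 2μ) δ_jk + t_jk` of `P₂`. -/
def a2coef (t : Fin 3 → Fin 3 → E3 → ℝ) (lam mu : E3 → ℝ) : Fin 3 → Fin 3 → E3 → ℝ :=
  fun j k x => (lam x + 2 * mu x) * (if j = k then 1 else 0) + t j k x

/-- The divergence `∇·u`. -/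
def divg (u : E3 → Fin 3 → ℝ) (x : E3) : ℝ := ∑ i, pd i (fun y => u y i) x

/-- The curl `∇×u`. -/
def curl (u : E3 → Fin 3 → ℝ) (x : E3) : Fin 3 → ℝ :=
  ![pd 1 (fun y => u y 2) x - pd 2 (fun y => u y 1) x,
    pd 2 (fun y => u y 0) x - pd 0 (fun y => u y 2) x,
    pd 0 (fun y => u y 1) x - pd 1 (fun y => u y 0) x]

/-- The infinitesimal strain `E = (∇u + (∇u)ᵗ)/2`. -/
def strain (u : E3 → Fin 3 → ℝ) (x : E3) (i j : Fin 3) : ℝ :=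
  (pd j (fun y => u y i) x + pd i (fun y => u y j) x) / 2

/-- The stress tensor `σ = T + (∇u)T + λ(tr E)I + 2μE`. -/
def stress (t : Fin 3 → Fin 3 → E3 → ℝ) (lam mu : E3 → ℝ) (u : E3 → Fin 3 → ℝ)
    (x : E3) (i j : Fin 3) : ℝ :=
  t i j x + (∑ k, pd k (fun y => u y i) x * t k j x)
    + lam x * divg u x * (if i = j then 1 else 0)
    + 2 * mu x * strain u x i j

/-- The residual stress system `∇·σ + κ²ρu = 0` on `Ω`. -/
def ResSystem (t : Fin 3 → Fin 3 → E3 → ℝ) (lam mu rho : E3 → ℝ) (κ : ℝ)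
    (u : E3 → Fin 3 → ℝ) (Ω : Set E3) : Prop :=
  ∀ x ∈ Ω, ∀ i : Fin 3,
    (∑ j, pd j (fun y => stress t lam mu u y i j) x) + κ ^ 2 * rho x * u x i = 0

/-- The vector `U = (u, ∇·u, ∇×u) : Ω → ℝ⁷`. -/
def Ufull (u : E3 → Fin 3 → ℝ) : E3 → Fin 7 → ℝ :=
  fun x => ![u x 0, u x 1, u x 2, divg u x, curl u x 0, curl u x 1, curl u x 2]

/-- The lower-order term `Σ_{|β|≤3} a_β ∂^β U`, component `i`. -/
def lowOrd (aβ : (Fin 3 → ℕ) → E3 → Fin 7 → Fin 7 → ℝ) (U : E3 → Fin 7 → ℝ)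
    (x : E3) (i : Fin 7) : ℝ :=
  ∑ β ∈ Finset.univ.filter (fun β : Fin 3 → Fin 4 => mdeg (fun k => (β k : ℕ)) ≤ 3),
    ∑ j, aβ (fun k => (β k : ℕ)) x i j * mpd (fun k => (β k : ℕ)) (fun y => U y j) x


/-- A commutative ring `A` with three commuting derivations, a differentially stable subring `G`
of coefficients and an increasing sequence of `G`-submodules `F m` ("order at most `m`") such that
differentiation raises the order by at most one. -/
structure FilteredDiffRing (A : Type*) [CommRing A] where
  /-- The partial derivatives. -/
  D : Fin 3 → Derivation ℤ A A
  D_comm : ∀ i j f, D i (D j f) = D j (D i f)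
  /-- The coefficients. -/
  G : Subring A
  D_mem : ∀ i {g}, g ∈ G → D i g ∈ G
  /-- The elements of order at most `m`. -/
  F : ℕ → Submodule G A
  F_mono : Monotone F
  D_F : ∀ i {m f}, f ∈ F m → D i f ∈ F (m + 1)

namespace FilteredDiffRing

variable {A : Type*} [CommRing A] (X : FilteredDiffRing A)

/-- The second-order operator `Σ_{j,k} a_jk D_j D_k`. -/
def op (a : Fin 3 → Fin 3 → A) (f : A) : A := ∑ j, ∑ k, a j k * X.D j (X.D k f)

variable {X} {a b : Fin 3 → Fin 3 → A} {f g : A} {m : ℕ}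

lemma mul_mem (hg : g ∈ X.G) (hf : f ∈ X.F m) : g * f ∈ X.F m :=
  (X.F m).smul_mem ⟨g, hg⟩ hf

lemma op_mem (ha : ∀ j k, a j k ∈ X.G) (hf : f ∈ X.F m) : X.op a f ∈ X.F (m + 2) :=
  Submodule.sum_mem _ fun j _ => Submodule.sum_mem _ fun k _ =>
    mul_mem (ha j k) (X.D_F j (X.D_F k hf))

lemma op_add : X.op a (f + g) = X.op a f + X.op a g := by
  simp only [op, map_add, mul_add, Finset.sum_add_distrib]

lemma op_sum {ι : Type*} (s : Finset ι) (h : ι → A) :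
    X.op a (∑ i ∈ s, h i) = ∑ i ∈ s, X.op a (h i) :=
  map_sum (AddMonoidHom.mk' (X.op a) fun _ _ => op_add) h s

lemma op_D (i : Fin 3) :
    X.op a (X.D i f) = X.D i (X.op a f) - X.op (fun j k => X.D i (a j k)) f := by
  simp only [op, map_sum, Derivation.leibniz, smul_eq_mul, ← Finset.sum_sub_distrib]
  refine Finset.sum_congr rfl fun j _ => Finset.sum_congr rfl fun k _ => ?_
  rw [X.D_comm k i, X.D_comm j i]
  ring

lemma op_mul_sub_mem (ha : ∀ j k, a j k ∈ X.G) (hg : g ∈ X.G) (hf : f ∈ X.F m) :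
    X.op a (g * f) - g * X.op a f ∈ X.F (m + 1) := by
  have key : X.op a (g * f) - g * X.op a f = ∑ j, ∑ k, (a j k * X.D j (X.D k g) * f +
      a j k * X.D k g * X.D j f + a j k * X.D j g * X.D k f) := by
    simp only [op, Derivation.leibniz, smul_eq_mul, map_add, Finset.mul_sum,
      ← Finset.sum_sub_distrib]
    refine Finset.sum_congr rfl fun j _ => Finset.sum_congr rfl fun k _ => ?_
    ring
  rw [key]
  refine Submodule.sum_mem _ fun j _ => Submodule.sum_mem _ fun k _ => ?_
  refine add_mem (add_mem ?_ ?_) ?_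
  · exact X.F_mono m.le_succ
      (mul_mem (X.G.mul_mem (ha j k) (X.D_mem j (X.D_mem k hg))) hf)
  · exact mul_mem (X.G.mul_mem (ha j k) (X.D_mem k hg)) (X.D_F j hf)
  · exact mul_mem (X.G.mul_mem (ha j k) (X.D_mem j hg)) (X.D_F k hf)

/-- The commutator of two second-order operators has order three. -/
lemma op_op_sub_mem (ha : ∀ j k, a j k ∈ X.G) (hb : ∀ j k, b j k ∈ X.G) (hf : f ∈ X.F m) :
    X.op a (X.op b f) - X.op b (X.op a f) ∈ X.F (m + 3) := by
  have key : X.op a (X.op b f) - X.op b (X.op a f) = ∑ j, ∑ k,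
      ((X.op a (b j k * X.D j (X.D k f)) - b j k * X.op a (X.D j (X.D k f))) -
        b j k * (X.op (fun p q => X.D j (a p q)) (X.D k f) +
          X.D j (X.op (fun p q => X.D k (a p q)) f))) := by
    conv_lhs => rw [op.eq_def X b, op.eq_def X b]
    simp only [op_sum, ← Finset.sum_sub_distrib]
    refine Finset.sum_congr rfl fun j _ => Finset.sum_congr rfl fun k _ => ?_
    rw [op_D j, op_D k (f := f), map_sub]
    ring
  rw [key]
  refine Submodule.sum_mem _ fun j _ => Submodule.sum_mem _ fun k _ => ?_
  refine sub_mem (op_mul_sub_mem ha (hb j k) (X.D_F j (X.D_F k hf)))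
    (mul_mem (hb j k) (add_mem ?_ ?_))
  · exact op_mem (fun p q => X.D_mem j (ha p q)) (X.D_F k hf)
  · exact X.D_F j (op_mem (fun p q => X.D_mem k (ha p q)) hf)

variable (X) in
/-- `f` has order at most `m`, and `op a` raises its order by at most one. -/
def Good (a : Fin 3 → Fin 3 → A) (m : ℕ) (f : A) : Prop :=
  f ∈ X.F m ∧ X.op a f ∈ X.F (m + 1)

lemma Good.of_mem (ha : ∀ j k, a j k ∈ X.G) (hf : f ∈ X.F m) : X.Good a (m + 1) f :=
  ⟨X.F_mono m.le_succ hf, op_mem ha hf⟩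

lemma Good.add (hf : X.Good a m f) (hg : X.Good a m g) : X.Good a m (f + g) :=
  ⟨add_mem hf.1 hg.1, op_add (X := X) ▸ add_mem hf.2 hg.2⟩

lemma Good.sum {ι : Type*} {s : Finset ι} {h : ι → A} (hh : ∀ i ∈ s, X.Good a m (h i)) :
    X.Good a m (∑ i ∈ s, h i) :=
  ⟨sum_mem fun i hi => (hh i hi).1, op_sum (X := X) s h ▸ sum_mem fun i hi => (hh i hi).2⟩

lemma Good.mul (ha : ∀ j k, a j k ∈ X.G) (hg : g ∈ X.G) (hf : X.Good a m f) :
    X.Good a m (g * f) := by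
  refine ⟨mul_mem hg hf.1, ?_⟩
  have := add_mem (op_mul_sub_mem ha hg hf.1) (mul_mem hg hf.2)
  rwa [sub_add_cancel] at this

lemma Good.neg (ha : ∀ j k, a j k ∈ X.G) (hf : X.Good a m f) : X.Good a m (-f) := by
  simpa using hf.mul ha (X.G.neg_mem X.G.one_mem)

lemma Good.sub (ha : ∀ j k, a j k ∈ X.G) (hf : X.Good a m f) (hg : X.Good a m g) :
    X.Good a m (f - g) :=
  sub_eq_add_neg f g ▸ hf.add (hg.neg ha)

lemma Good.D (ha : ∀ j k, a j k ∈ X.G) (i : Fin 3) (hf : X.Good a m f) :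
    X.Good a (m + 1) (X.D i f) := by
  refine ⟨X.D_F i hf.1, ?_⟩
  rw [op_D]
  exact sub_mem (X.D_F i hf.2) (op_mem (fun j k => X.D_mem i (ha j k)) hf.1)

lemma Good.op (ha : ∀ j k, a j k ∈ X.G) (hb : ∀ j k, b j k ∈ X.G) (hf : X.Good a m f) :
    X.Good a (m + 2) (X.op b f) :=
  .sum fun j _ => .sum fun k _ => ((hf.D ha k).D ha j).mul ha (hb j k)

variable (X) in
/-- The algebraic form of the residual stress system. -/
structure Solves (t : Fin 3 → Fin 3 → A) (lam mu q : A) (u : Fin 3 → A) : Prop where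
  div_eq_zero : ∀ i, ∑ j, X.D j (t i j) = 0
  system : ∀ i, ∑ j, X.D j (t i j + (∑ k, X.D k (u i) * t k j) +
    lam * (∑ k, X.D k (u k)) * (if i = j then 1 else 0) +
    mu * (X.D j (u i) + X.D i (u j))) + q * u i = 0

section System

variable {t : Fin 3 → Fin 3 → A} {lam mu q : A} {u : Fin 3 → A}

/-- The coefficients `c δ_jk + t_jk`. -/
def coef (t : Fin 3 → Fin 3 → A) (c : A) (j k : Fin 3) : A :=
  c * (if j = k then 1 else 0) + t j k

lemma coef_mem {c : A} (ht : ∀ j k, t j k ∈ X.G) (hc : c ∈ X.G) (j k : Fin 3) :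
    coef t c j k ∈ X.G := by
  refine X.G.add_mem (X.G.mul_mem hc ?_) (ht j k)
  split_ifs
  exacts [X.G.one_mem, X.G.zero_mem]

lemma op_coef_add (c d : A) :
    X.op (coef t (c + d)) f = X.op (coef t c) f + d * ∑ j, X.D j (X.D j f) := by
  simp only [op, coef, Fin.sum_univ_three]
  simp
  ring

variable (X) in
/-- The lower-order part of the system. -/
def rem (lam mu q : A) (u : Fin 3 → A) (i : Fin 3) : A :=
  X.D i lam * (∑ k, X.D k (u k)) + (∑ j, X.D j mu * (X.D j (u i) + X.D i (u j))) + q * u i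

lemma Solves.op_eq (h : X.Solves t lam mu q u) (i : Fin 3) :
    X.op (coef t mu) (u i) =
      -((lam + mu) * X.D i (∑ k, X.D k (u k)) + X.rem lam mu q u i) := by
  have hs := h.system i
  have h0 := h.div_eq_zero 0
  have h1 := h.div_eq_zero 1
  have h2 := h.div_eq_zero 2
  have hi := h.div_eq_zero i
  simp only [op, coef, rem, Fin.sum_univ_three, map_add, Derivation.leibniz, smul_eq_mul,
    X.D_comm 1 0, X.D_comm 2 0, X.D_comm 2 1] at *
  fin_cases i <;> simp at * <;>
  simp only [X.D_comm 1 0, X.D_comm 2 0, X.D_comm 2 1] at *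
  · linear_combination hs - hi - X.D 0 (u 0) * h0 - X.D 1 (u 0) * h1 - X.D 2 (u 0) * h2
  · linear_combination hs - hi - X.D 0 (u 1) * h0 - X.D 1 (u 1) * h1 - X.D 2 (u 1) * h2
  · linear_combination hs - hi - X.D 0 (u 2) * h0 - X.D 1 (u 2) * h1 - X.D 2 (u 2) * h2

lemma laplacian_eq (i : Fin 3) : ∑ j, X.D j (X.D j (u i)) =
    (∑ j, X.D j (X.D j (u i) - X.D i (u j))) + X.D i (∑ j, X.D j (u j)) := by
  simp only [map_sub, map_sum, ← Finset.sum_add_distrib]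
  refine Finset.sum_congr rfl fun j _ => ?_
  rw [X.D_comm i j]
  ring

variable (X) in
/-- All data have coefficients in `G`, and `u`, its divergence and its curl have order zero. -/
structure Admissible (t : Fin 3 → Fin 3 → A) (lam mu q : A) (u : Fin 3 → A) : Prop where
  solves : X.Solves t lam mu q u
  t_mem : ∀ j k, t j k ∈ X.G
  lam_mem : lam ∈ X.G
  mu_mem : mu ∈ X.G
  q_mem : q ∈ X.G
  u_mem : ∀ i, u i ∈ X.F 0
  div_mem : ∑ k, X.D k (u k) ∈ X.F 0
  curl_mem : ∀ j k, X.D j (u k) - X.D k (u j) ∈ X.F 0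

namespace Admissible

lemma rem_mem (h : X.Admissible t lam mu q u) (i : Fin 3) : X.rem lam mu q u i ∈ X.F 1 := by
  refine add_mem (add_mem ?_ ?_) ?_
  · exact X.F_mono zero_le_one (mul_mem (X.D_mem i h.lam_mem) h.div_mem)
  · exact sum_mem fun j _ => mul_mem (X.D_mem j h.mu_mem)
      (add_mem (X.D_F j (h.u_mem i)) (X.D_F i (h.u_mem j)))
  · exact X.F_mono zero_le_one (mul_mem h.q_mem (h.u_mem i))

lemma good_shear (h : X.Admissible t lam mu q u) (i : Fin 3) : X.Good (coef t mu) 0 (u i) := by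
  refine ⟨h.u_mem i, ?_⟩
  rw [h.solves.op_eq]
  exact neg_mem (add_mem (mul_mem (X.G.add_mem h.lam_mem h.mu_mem) (X.D_F i h.div_mem))
    (h.rem_mem i))

lemma good_pressure (h : X.Admissible t lam mu q u) (i : Fin 3) :
    X.Good (coef t (mu + (lam + mu))) 0 (u i) := by
  refine ⟨h.u_mem i, ?_⟩
  rw [op_coef_add, laplacian_eq]
  exact add_mem (h.good_shear i).2 (mul_mem (X.G.add_mem h.lam_mem h.mu_mem)
    (add_mem (sum_mem fun j _ => X.D_F j (h.curl_mem j i)) (X.D_F i h.div_mem)))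

lemma good_rem (h : X.Admissible t lam mu q u) (ha : ∀ j k, a j k ∈ X.G)
    (hu : ∀ i, X.Good a 0 (u i)) (i : Fin 3) :
    X.Good a 1 (X.rem lam mu q u i) := by
  refine .add (.add ?_ ?_) ?_
  · exact .of_mem ha (mul_mem (X.D_mem i h.lam_mem) h.div_mem)
  · exact .sum fun j _ => .mul ha (X.D_mem j h.mu_mem) (.add ((hu i).D ha j) ((hu j).D ha i))
  · exact .of_mem ha (mul_mem h.q_mem (h.u_mem i))

lemma shear_mem (h : X.Admissible t lam mu q u) (j k : Fin 3) : coef t mu j k ∈ X.G :=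
  coef_mem h.t_mem h.mu_mem j k

lemma pressure_mem (h : X.Admissible t lam mu q u) (j k : Fin 3) :
    coef t (mu + (lam + mu)) j k ∈ X.G :=
  coef_mem h.t_mem (X.G.add_mem h.mu_mem (X.G.add_mem h.lam_mem h.mu_mem)) j k

theorem op_op_displacement (h : X.Admissible t lam mu q u) (i : Fin 3) :
    X.op (coef t (mu + (lam + mu))) (X.op (coef t mu) (u i)) ∈ X.F 3 :=
  op_mem h.pressure_mem (h.good_shear i).2

theorem op_op_curl (h : X.Admissible t lam mu q u) (j k : Fin 3) :
    X.op (coef t (mu + (lam + mu))) (X.op (coef t mu) (X.D j (u k) - X.D k (u j))) ∈ X.F 3 := by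
  have key : X.op (coef t mu) (X.D j (u k) - X.D k (u j)) =
      (X.D k (lam + mu) * X.D j (∑ k, X.D k (u k)) -
        X.D j (lam + mu) * X.D k (∑ k, X.D k (u k))) +
      (X.D k (X.rem lam mu q u j) - X.D j (X.rem lam mu q u k)) +
      (X.op (fun p r => X.D k (coef t mu p r)) (u j) -
        X.op (fun p r => X.D j (coef t mu p r)) (u k)) := by
    have hsub : X.op (coef t mu) (X.D j (u k) - X.D k (u j)) =
        X.op (coef t mu) (X.D j (u k)) - X.op (coef t mu) (X.D k (u j)) :=
      map_sub (AddMonoidHom.mk' (X.op (coef t mu)) fun _ _ => op_add) _ _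
    rw [hsub, op_D, op_D, h.solves.op_eq, h.solves.op_eq]
    simp only [map_neg, map_add (X.D _) (_ * _), Derivation.leibniz, smul_eq_mul, X.D_comm k j]
    ring
  have hP := h.pressure_mem
  have hlm := X.G.add_mem h.lam_mem h.mu_mem
  have hu := h.good_pressure
  have : X.Good (coef t (mu + (lam + mu))) 2
      (X.op (coef t mu) (X.D j (u k) - X.D k (u j))) := by
    rw [key]
    refine .add (.add ?_ ?_) ?_
    · exact .of_mem hP (sub_mem (mul_mem (X.D_mem k hlm) (X.D_F j h.div_mem))
        (mul_mem (X.D_mem j hlm) (X.D_F k h.div_mem)))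
    · exact ((h.good_rem hP hu j).D hP k).sub hP ((h.good_rem hP hu k).D hP j)
    · exact ((hu j).op hP fun p r => X.D_mem k (h.shear_mem p r)).sub hP
        ((hu k).op hP fun p r => X.D_mem j (h.shear_mem p r))
  exact this.2

theorem op_op_div (h : X.Admissible t lam mu q u) :
    X.op (coef t (mu + (lam + mu))) (X.op (coef t mu) (∑ i, X.D i (u i))) ∈ X.F 3 := by
  have key : X.op (coef t (mu + (lam + mu))) (∑ i, X.D i (u i)) =
      -∑ i, (X.D i (lam + mu) * X.D i (∑ k, X.D k (u k)) + X.D i (X.rem lam mu q u i) +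
        X.op (fun p r => X.D i (coef t mu p r)) (u i)) := by
    rw [op_coef_add, op_sum, Finset.mul_sum, ← Finset.sum_add_distrib, ← Finset.sum_neg_distrib]
    refine Finset.sum_congr rfl fun i _ => ?_
    rw [op_D, h.solves.op_eq]
    simp only [map_neg, map_add (X.D _) (_ * _), Derivation.leibniz, smul_eq_mul]
    ring
  have hP := h.shear_mem
  have hlm := X.G.add_mem h.lam_mem h.mu_mem
  have hu := h.good_shear
  have hgood : X.Good (coef t mu) 2 (X.op (coef t (mu + (lam + mu))) (∑ i, X.D i (u i))) := by
    rw [key]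
    refine .neg hP (.sum fun i _ => .add (.add ?_ ?_) ?_)
    · exact .of_mem hP (mul_mem (X.D_mem i hlm) (X.D_F i h.div_mem))
    · exact (h.good_rem hP hu i).D hP i
    · exact (hu i).op hP fun p r => X.D_mem i (h.shear_mem p r)
  have := add_mem (op_op_sub_mem h.pressure_mem h.shear_mem h.div_mem) hgood.2
  rwa [sub_add_cancel] at this

end Admissible

end System

end FilteredDiffRing

open TopologicalSpace (Opens)

section Pd

variable {Ω : Set E3} {f g : E3 → ℝ}

lemma pd_congr (hΩ : IsOpen Ω) (i : Fin 3) (h : Set.EqOn f g Ω) :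
    Set.EqOn (pd i f) (pd i g) Ω := fun x hx => by
  simp only [pd, (h.eventuallyEq_of_mem (hΩ.mem_nhds hx)).fderiv_eq]

lemma contDiffOn_pd (hΩ : IsOpen Ω) (i : Fin 3) (hf : ContDiffOn ℝ (⊤ : ℕ∞) f Ω) :
    ContDiffOn ℝ (⊤ : ℕ∞) (pd i f) Ω :=
  (hf.fderiv_of_isOpen hΩ (by norm_cast)).clm_apply contDiffOn_const

lemma differentiableAt_of_contDiffOn (hΩ : IsOpen Ω) (hf : ContDiffOn ℝ (⊤ : ℕ∞) f Ω) {x : E3}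
    (hx : x ∈ Ω) : DifferentiableAt ℝ f x :=
  (hf.contDiffAt (hΩ.mem_nhds hx)).differentiableAt (by simp)

lemma pd_comm (hΩ : IsOpen Ω) (hf : ContDiffOn ℝ (⊤ : ℕ∞) f Ω) (i j : Fin 3) {x : E3}
    (hx : x ∈ Ω) : pd i (pd j f) x = pd j (pd i f) x := by
  have hd : DifferentiableAt ℝ (fderiv ℝ f) x :=
    ((hf.fderiv_of_isOpen (m := 1) hΩ (by norm_cast)).contDiffAt
      (hΩ.mem_nhds hx)).differentiableAt (by simp)
  have hs : IsSymmSndFDerivAt ℝ f x :=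
    (hf.contDiffAt (hΩ.mem_nhds hx)).isSymmSndFDerivAt (by
      rw [minSmoothness_of_isRCLikeNormedField]; exact WithTop.coe_le_coe.2 le_top)
  have (i j : Fin 3) : pd i (pd j f) x =
      fderiv ℝ (fderiv ℝ f) x (EuclideanSpace.single i 1) (EuclideanSpace.single j 1) := by
    unfold pd
    rw [fderiv_clm_apply hd (differentiableAt_const _)]
    simp
  rw [this, this, hs]

end Pd

/-- Extension by zero of a function on `Ω`. -/
def zext {Ω : Opens E3} (f : Ω → ℝ) : E3 → ℝ := Function.extend Subtype.val f 0

lemma zext_apply {Ω : Opens E3} (f : Ω → ℝ) (x : Ω) : zext f x = f x :=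
  Subtype.val_injective.extend_apply f 0 x

lemma zext_eqOn {Ω : Opens E3} {f : Ω → ℝ} {F : E3 → ℝ} (h : ∀ x : Ω, F x = f x) :
    Set.EqOn (zext f) F Ω := fun x hx => by
  rw [h ⟨x, hx⟩, ← zext_apply f]

/-- The ring of smooth functions on `Ω`. -/
def smoothRing (Ω : Opens E3) : Subring (Ω → ℝ) where
  carrier := {f | ContDiffOn ℝ (⊤ : ℕ∞) (zext f) Ω}
  zero_mem' := contDiffOn_const (c := (0 : ℝ)).congr (zext_eqOn fun _ => rfl)
  one_mem' := contDiffOn_const (c := (1 : ℝ)).congr (zext_eqOn fun _ => rfl)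
  add_mem' {f g} hf hg := (ContDiffOn.add hf hg).congr
    (zext_eqOn fun x => by simp [zext_apply])
  mul_mem' {f g} hf hg := (ContDiffOn.mul hf hg).congr
    (zext_eqOn fun x => by simp [zext_apply])
  neg_mem' {f} hf := (ContDiffOn.neg hf).congr
    (zext_eqOn fun _ => by simp [zext_apply])

section SmoothRing

variable {Ω : Opens E3} {F H : E3 → ℝ} {f h : smoothRing Ω}

/-- The restriction to `Ω` of a function which is smooth on `Ω`. -/
def restr (F : E3 → ℝ) (hF : ContDiffOn ℝ (⊤ : ℕ∞) F Ω) : smoothRing Ω :=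
  ⟨fun x => F x, hF.congr (zext_eqOn fun _ => rfl)⟩

/-- The function `F` represents the element `f` of `smoothRing Ω`. -/
def Represents (F : E3 → ℝ) (f : smoothRing Ω) : Prop := ∀ x : Ω, F x = f.1 x

lemma represents_restr (hF : ContDiffOn ℝ (⊤ : ℕ∞) F Ω) : Represents F (restr F hF) :=
  fun _ => rfl

lemma represents_zext (f : smoothRing Ω) : Represents (zext f.1) f := zext_apply f.1

lemma Represents.eqOn (hF : Represents F f) : Set.EqOn (zext f.1) F Ω := zext_eqOn hF

lemma Represents.contDiffOn (hF : Represents F f) : ContDiffOn ℝ (⊤ : ℕ∞) F Ω :=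
  f.2.congr fun _ hx => (hF.eqOn hx).symm

lemma Represents.ext (hF : Represents F f) (hH : Represents F h) : f = h :=
  Subtype.ext (funext fun x => (hF x).symm.trans (hH x))

lemma Represents.add (hF : Represents F f) (hH : Represents H h) :
    Represents (fun x => F x + H x) (f + h) :=
  fun x => congrArg₂ (· + ·) (hF x) (hH x)

lemma Represents.sub (hF : Represents F f) (hH : Represents H h) :
    Represents (fun x => F x - H x) (f - h) :=
  fun x => congrArg₂ (· - ·) (hF x) (hH x)

lemma Represents.mul (hF : Represents F f) (hH : Represents H h) :
    Represents (fun x => F x * H x) (f * h) :=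
  fun x => congrArg₂ (· * ·) (hF x) (hH x)

lemma represents_zero : Represents (fun _ => 0) (0 : smoothRing Ω) := fun _ => rfl

lemma represents_one : Represents (fun _ => 1) (1 : smoothRing Ω) := fun _ => rfl

lemma Represents.sum {ι : Type*} {s : Finset ι} {F : ι → E3 → ℝ} {f : ι → smoothRing Ω}
    (hF : ∀ i, Represents (F i) (f i)) : Represents (fun x => ∑ i ∈ s, F i x) (∑ i ∈ s, f i) :=
  fun x => by simp [hF _ x]

variable (Ω) in
/-- The partial derivatives as derivations of the ring of smooth functions. -/
def smoothD (i : Fin 3) : Derivation ℤ (smoothRing Ω) (smoothRing Ω) :=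
  Derivation.mk' (AddMonoidHom.mk'
    (fun f => restr (pd i (zext f.1)) (contDiffOn_pd Ω.2 i f.2)) (fun f h => by
      refine Subtype.ext (funext fun x => ?_)
      have hfh := (represents_zext f).add (represents_zext h)
      refine (pd_congr Ω.2 i hfh.eqOn x.2).trans ?_
      simp only [pd]
      rw [fderiv_fun_add (differentiableAt_of_contDiffOn Ω.2 f.2 x.2)
        (differentiableAt_of_contDiffOn Ω.2 h.2 x.2)]
      rfl)).toIntLinearMap (fun f h => by
    refine Subtype.ext (funext fun x => ?_)
    have hfh := (represents_zext f).mul (represents_zext h)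
    refine (pd_congr Ω.2 i hfh.eqOn x.2).trans ?_
    simp only [pd]
    rw [fderiv_fun_mul (differentiableAt_of_contDiffOn Ω.2 f.2 x.2)
      (differentiableAt_of_contDiffOn Ω.2 h.2 x.2)]
    simp [zext_apply, restr, pd])

lemma Represents.pd (hF : Represents F f) (i : Fin 3) :
    Represents (pd i F) (smoothD Ω i f) :=
  fun x => (pd_congr Ω.2 i hF.eqOn x.2).symm

lemma smoothD_comm (i j : Fin 3) (f : smoothRing Ω) :
    smoothD Ω i (smoothD Ω j f) = smoothD Ω j (smoothD Ω i f) := by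
  refine Subtype.ext (funext fun x => ?_)
  have hf := represents_zext f
  rw [← (hf.pd j).pd i x, ← (hf.pd i).pd j x]
  exact pd_comm Ω.2 f.2 i j x.2

/-- The multiindex derivative formed with abstract operators. -/
def multiD {R : Type*} (D : Fin 3 → R → R) (β : Fin 3 → ℕ) (f : R) : R :=
  (D 0)^[β 0] ((D 1)^[β 1] ((D 2)^[β 2] f))

lemma apply_multiD {R : Type*} {D : Fin 3 → R → R} (hD : ∀ i j f, D i (D j f) = D j (D i f))
    (i : Fin 3) (β : Fin 3 → ℕ) (f : R) :
    D i (multiD D β f) = multiD D (β + Pi.single i 1) f := by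
  have hc (i j : Fin 3) (n : ℕ) (g : R) : D i ((D j)^[n] g) = (D j)^[n] (D i g) :=
    Function.Commute.iterate_right (fun f => hD i j f) n g
  fin_cases i <;> simp [multiD, Function.iterate_succ_apply', hc 1 0, hc 2 0, hc 2 1]

lemma mdeg_add_single (β : Fin 3 → ℕ) (i : Fin 3) : mdeg (β + Pi.single i 1) = mdeg β + 1 := by
  fin_cases i <;> simp [mdeg] <;> omega

lemma foldr_eq_multiD {R : Type*} {D : Fin 3 → R → R}
    (hD : ∀ i j f, D i (D j f) = D j (D i f)) (w : List (Fin 3)) (f : R) :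
    ∃ β, mdeg β = w.length ∧ w.foldr D f = multiD D β f := by
  induction w with
  | nil => exact ⟨0, rfl, rfl⟩
  | cons i w ih =>
    obtain ⟨β, h1, h2⟩ := ih
    exact ⟨β + Pi.single i 1, by rw [mdeg_add_single, h1, List.length_cons],
      by rw [List.foldr_cons, h2, apply_multiD hD]⟩

lemma multiD_eq_foldr {R : Type*} (D : Fin 3 → R → R) (β : Fin 3 → ℕ) (f : R) :
    ∃ w : List (Fin 3), w.length = mdeg β ∧ multiD D β f = w.foldr D f := by
  have hr (i : Fin 3) (n : ℕ) (g : R) : (List.replicate n i).foldr D g = (D i)^[n] g := by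
    induction n with
    | zero => rfl
    | succ n ih => rw [List.replicate_succ, List.foldr_cons, ih, Function.iterate_succ_apply']
  exact ⟨List.replicate (β 0) 0 ++ List.replicate (β 1) 1 ++ List.replicate (β 2) 2,
    by simp [mdeg, add_assoc], by simp [multiD, hr]⟩

lemma Represents.mpd (hF : Represents F f) (β : Fin 3 → ℕ) :
    Represents (mpd β F) (multiD (fun i => smoothD Ω i) β f) := by
  have hr (i : Fin 3) (n : ℕ) {F : E3 → ℝ} {f : smoothRing Ω} (hF : Represents F f) :
      Represents ((_root_.pd i)^[n] F) ((smoothD Ω i)^[n] f) := by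
    induction n with
    | zero => exact hF
    | succ n ih =>
      rw [Function.iterate_succ_apply', Function.iterate_succ_apply']
      exact ih.pd i
  exact hr 0 _ (hr 1 _ (hr 2 _ hF))

end SmoothRing

section Gevrey

variable {Ω : Opens E3}

/-- All derivatives of order `n` of `f` along coordinate directions are bounded by `a n`. -/
def DerivBound (f : smoothRing Ω) (a : ℕ → ℝ) : Prop :=
  ∀ (w : List (Fin 3)) (x : Ω), |(w.foldr (fun i => smoothD Ω i) f).1 x| ≤ a w.length

variable {f g : smoothRing Ω} {a b : ℕ → ℝ}

lemma DerivBound.of_smoothD (hf : DerivBound f a) (i : Fin 3) :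
    DerivBound (smoothD Ω i f) (fun n => a (n + 1)) := fun w x => by
  simpa using hf (w ++ [i]) x

lemma foldr_smoothD_add (w : List (Fin 3)) (f g : smoothRing Ω) :
    w.foldr (fun i => smoothD Ω i) (f + g) =
      w.foldr (fun i => smoothD Ω i) f + w.foldr (fun i => smoothD Ω i) g := by
  induction w with
  | nil => rfl
  | cons i w ih => simp only [List.foldr_cons, ih, map_add]

lemma DerivBound.mono (hf : DerivBound f a) (h : ∀ n, a n ≤ b n) : DerivBound f b :=
  fun w x => (hf w x).trans (h _)

lemma DerivBound.add (hf : DerivBound f a) (hg : DerivBound g b) :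
    DerivBound (f + g) (fun n => a n + b n) := fun w x => by
  rw [foldr_smoothD_add]
  exact (abs_add_le _ _).trans (add_le_add (hf w x) (hg w x))

lemma DerivBound.mul (hf : DerivBound f a) (hg : DerivBound g b) :
    DerivBound (f * g) (fun n => ∑ ij ∈ antidiagonal n,
      (n.choose ij.1 : ℝ) * (a ij.1 * b ij.2)) := by
  intro w
  induction w using List.reverseRecOn generalizing f g a b with
  | nil =>
    intro x
    have hf' := hf [] x
    have hg' := hg [] x
    simp only [List.foldr_nil, List.length_nil] at hf' hg' ⊢
    simpa [abs_mul] using mul_le_mul hf' hg' (abs_nonneg _) ((abs_nonneg _).trans hf')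
  | append_singleton w i ih =>
    intro x
    rw [List.foldr_append, List.foldr_cons, List.foldr_nil, Derivation.leibniz, smul_eq_mul,
      smul_eq_mul, foldr_smoothD_add, List.length_append, List.length_singleton]
    beta_reduce
    rw [sum_antidiagonal_choose_succ_mul (fun i j => a i * b j)]
    refine (abs_add_le _ _).trans (add_le_add (ih hf (hg.of_smoothD i) x) ?_)
    rw [mul_comm g]
    refine (ih (hf.of_smoothD i) hg x).trans_eq (Finset.sum_congr rfl fun ij hij => ?_)
    rw [← mem_antidiagonal.1 hij, Nat.choose_symm_add]

/-- Constants satisfy Gevrey bounds. -/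
lemma Represents.derivBound {r : ℝ} (hf : Represents (fun _ => r) f) (s : ℝ) :
    DerivBound f fun n => (|r| + 1) * 1 ^ n * (n.factorial : ℝ) ^ s := fun w x => by
  have hD (i : Fin 3) : smoothD Ω i f = 0 :=
    (hf.pd i).ext fun x => by simp [_root_.pd]
  have hw : w = [] ∨ w.foldr (fun i => smoothD Ω i) f = 0 := by
    induction w with
    | nil => exact .inl rfl
    | cons i w ih =>
      rcases ih with rfl | ih
      · exact .inr (hD i)
      · exact .inr (by rw [List.foldr_cons, ih, map_zero])
  rcases hw with rfl | hw
  · simp [← hf x]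
  · rw [hw]
    simp only [ZeroMemClass.coe_zero, Pi.zero_apply, abs_zero]
    positivity

/-- The subring of smooth functions in the Gevrey class `G^s(Ω)`. -/
def gevreyRing (Ω : Opens E3) {s : ℝ} (hs : 0 ≤ s) : Subring (smoothRing Ω) where
  carrier := {f | ∃ c > 0, ∃ A > 0, DerivBound f fun n => c * A ^ n * (n.factorial : ℝ) ^ s}
  zero_mem' := ⟨_, by positivity, _, one_pos, represents_zero.derivBound s⟩
  one_mem' := ⟨_, by positivity, _, one_pos, represents_one.derivBound s⟩
  neg_mem' := by
    rintro f ⟨c, hc, A, hA, hf⟩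
    refine ⟨c, hc, A, hA, fun w x => ?_⟩
    have : w.foldr (fun i => smoothD Ω i) (-f) = -w.foldr (fun i => smoothD Ω i) f := by
      induction w with
      | nil => rfl
      | cons i w ih => rw [List.foldr_cons, ih, map_neg, List.foldr_cons]
    rw [this]
    simpa using hf w x
  add_mem' := by
    rintro f g ⟨c, hc, A, hA, hf⟩ ⟨c', hc', A', hA', hg⟩
    refine ⟨c + c', by positivity, A + A', by positivity, (hf.add hg).mono fun n => ?_⟩
    rw [← add_mul, add_mul c]
    gcongr
    · linarith
    · linarith
  mul_mem' := by
    rintro f g ⟨c, hc, A, hA, hf⟩ ⟨c', hc', A', hA', hg⟩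
    refine ⟨c * c', by positivity, A + A', by positivity, (hf.mul hg).mono fun n => ?_⟩
    rw [(Commute.all A A').add_pow', Finset.mul_sum, Finset.sum_mul]
    refine Finset.sum_le_sum fun ij hij => ?_
    have hfac : (ij.1.factorial : ℝ) ^ s * (ij.2.factorial : ℝ) ^ s ≤ (n.factorial : ℝ) ^ s := by
      rw [← Real.mul_rpow (by positivity) (by positivity), ← mem_antidiagonal.1 hij]
      refine Real.rpow_le_rpow (by positivity) ?_ hs
      exact_mod_cast Nat.le_of_dvd (Nat.factorial_pos _)
        (Nat.factorial_mul_factorial_dvd_factorial_add _ _)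
    rw [nsmul_eq_mul]
    calc (n.choose ij.1 : ℝ) * (c * A ^ ij.1 * (ij.1.factorial : ℝ) ^ s *
          (c' * A' ^ ij.2 * (ij.2.factorial : ℝ) ^ s))
        = c * c' * (n.choose ij.1 * (A ^ ij.1 * A' ^ ij.2)) *
          ((ij.1.factorial : ℝ) ^ s * (ij.2.factorial : ℝ) ^ s) := by ring
      _ ≤ _ := by gcongr

variable {s : ℝ} (hs : 0 ≤ s)

lemma smoothD_mem_gevreyRing (i : Fin 3) (hf : f ∈ gevreyRing Ω hs) :
    smoothD Ω i f ∈ gevreyRing Ω hs := by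
  obtain ⟨c, hc, A, hA, hf⟩ := hf
  refine ⟨c * A, by positivity, A * 2 ^ s, by positivity, (hf.of_smoothD i).mono fun n => ?_⟩
  have h2 : ((n + 1 : ℕ) : ℝ) ^ s ≤ (2 ^ s) ^ n := by
    rw [← Real.rpow_natCast, ← Real.rpow_mul (by norm_num), mul_comm s,
      Real.rpow_mul (by norm_num), Real.rpow_natCast]
    refine Real.rpow_le_rpow (by positivity) ?_ hs
    exact_mod_cast n.lt_two_pow_self
  rw [Nat.factorial_succ, Nat.cast_mul, Real.mul_rpow (by positivity) (by positivity), mul_pow,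
    pow_succ]
  calc c * (A ^ n * A) * (((n + 1 : ℕ) : ℝ) ^ s * (n.factorial : ℝ) ^ s)
      ≤ c * (A ^ n * A) * ((2 ^ s) ^ n * (n.factorial : ℝ) ^ s) := by gcongr
    _ = _ := by ring

lemma Represents.gevreyOn_iff {F : E3 → ℝ} (hF : Represents F f) :
    GevreyOn s Ω F ↔ f ∈ gevreyRing Ω hs := by
  refine ⟨fun ⟨_, c, hc, A, hA, h⟩ => ⟨c, hc, A, hA, fun w x => ?_⟩,
    fun ⟨c, hc, A, hA, h⟩ => ⟨hF.contDiffOn, c, hc, A, hA, fun β x hx => ?_⟩⟩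
  · obtain ⟨β, h1, h2⟩ := foldr_eq_multiD (D := fun i => smoothD Ω i) smoothD_comm w f
    rw [h2, ← h1, ← hF.mpd β x]
    exact h β x x.2
  · obtain ⟨w, h1, h2⟩ := multiD_eq_foldr (fun i => smoothD Ω i) β f
    rw [hF.mpd β ⟨x, hx⟩, h2, ← h1]
    exact h w ⟨x, hx⟩

end Gevrey

namespace FilteredDiffRing

variable {A : Type*} [CommRing A]

/-- The filtration in which the `m`-th step is spanned by the derivatives of order at most `m`
of the components of a vector `V`. -/
def ofVec (D : Fin 3 → Derivation ℤ A A) (D_comm : ∀ i j f, D i (D j f) = D j (D i f))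
    (G : Subring A) (D_mem : ∀ i {g}, g ∈ G → D i g ∈ G) (V : Fin 7 → A) :
    FilteredDiffRing A where
  D := D
  D_comm := D_comm
  G := G
  D_mem := D_mem
  F m := Submodule.span G {f | ∃ β j, mdeg β ≤ m ∧ multiD (fun i => D i) β (V j) = f}
  F_mono _ _ hmn := Submodule.span_mono fun _ ⟨β, j, hβ, h⟩ => ⟨β, j, hβ.trans hmn, h⟩
  D_F i m f hf := by
    induction hf using Submodule.span_induction with
    | mem f hf =>
      obtain ⟨β, j, hβ, rfl⟩ := hf
      refine Submodule.subset_span ⟨β + Pi.single i 1, j, ?_, ?_⟩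
      · rw [mdeg_add_single]
        omega
      · exact (apply_multiD (D := fun i => D i) D_comm i β (V j)).symm
    | zero => rw [map_zero]; exact zero_mem _
    | add f g _ _ hf hg => rw [map_add]; exact add_mem hf hg
    | smul g f h hf =>
      rw [Subring.smul_def, smul_eq_mul, Derivation.leibniz]
      refine add_mem (Submodule.smul_mem _ g hf) ?_
      rw [smul_eq_mul, mul_comm]
      exact Submodule.smul_mem _ (⟨D i g, D_mem i g.2⟩ : G)
        (Submodule.span_mono (by
          rintro _ ⟨β, j, hβ, rfl⟩
          exact ⟨β, j, hβ.trans m.le_succ, rfl⟩) h)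

/-- The vector `(u, ∇·u, ∇×u)`. -/
def fullVec (D : Fin 3 → Derivation ℤ A A) (u : Fin 3 → A) : Fin 7 → A :=
  ![u 0, u 1, u 2, ∑ k, D k (u k), D 1 (u 2) - D 2 (u 1), D 2 (u 0) - D 0 (u 2),
    D 0 (u 1) - D 1 (u 0)]

variable {X : FilteredDiffRing A} {t : Fin 3 → Fin 3 → A} {lam mu q : A} {u : Fin 3 → A}

lemma Solves.admissible (h : X.Solves t lam mu q u) (ht : ∀ j k, t j k ∈ X.G)
    (hlam : lam ∈ X.G) (hmu : mu ∈ X.G) (hq : q ∈ X.G) (hF : ∀ j, fullVec X.D u j ∈ X.F 0) :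
    X.Admissible t lam mu q u where
  solves := h
  t_mem := ht
  lam_mem := hlam
  mu_mem := hmu
  q_mem := hq
  u_mem i := by
    fin_cases i
    exacts [hF 0, hF 1, hF 2]
  div_mem := hF 3
  curl_mem j k := by
    have h0 : X.D 1 (u 2) - X.D 2 (u 1) ∈ X.F 0 := hF 4
    have h1 : X.D 2 (u 0) - X.D 0 (u 2) ∈ X.F 0 := hF 5
    have h2 : X.D 0 (u 1) - X.D 1 (u 0) ∈ X.F 0 := hF 6
    have h0' := neg_mem h0
    have h1' := neg_mem h1
    have h2' := neg_mem h2
    rw [neg_sub] at h0' h1' h2'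
    fin_cases j <;> fin_cases k <;> first | assumption | (rw [sub_self]; exact zero_mem _)

theorem Admissible.op_op_fullVec (h : X.Admissible t lam mu q u) (j : Fin 7) :
    X.op (coef t (mu + (lam + mu))) (X.op (coef t mu) (fullVec X.D u j)) ∈ X.F 3 := by
  fin_cases j
  exacts [h.op_op_displacement 0, h.op_op_displacement 1, h.op_op_displacement 2, h.op_op_div,
    h.op_op_curl 1 2, h.op_op_curl 2 0, h.op_op_curl 0 1]

end FilteredDiffRing

section Families

variable (S : Type*) (Ω : Opens E3)

/-- The partial derivatives of families of smooth functions. -/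
def familyD (i : Fin 3) : Derivation ℤ (S → smoothRing Ω) (S → smoothRing Ω) :=
  Derivation.mk' (AddMonoidHom.mk' (fun (f : S → smoothRing Ω) v => smoothD Ω i (f v))
    fun f g => funext fun v => map_add _ (f v) (g v)).toIntLinearMap
    fun f g => funext fun v => (smoothD Ω i).leibniz (f v) (g v)

variable {S Ω}

lemma familyD_apply (i : Fin 3) (f : S → smoothRing Ω) (v : S) :
    familyD S Ω i f v = smoothD Ω i (f v) := rfl

lemma multiD_familyD_apply (β : Fin 3 → ℕ) (f : S → smoothRing Ω) (v : S) :
    multiD (fun i => familyD S Ω i) β f v = multiD (fun i => smoothD Ω i) β (f v) := by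
  have hr (i : Fin 3) (n : ℕ) (f : S → smoothRing Ω) :
      (familyD S Ω i)^[n] f v = (smoothD Ω i)^[n] (f v) := by
    induction n with
    | zero => rfl
    | succ n ih =>
      rw [Function.iterate_succ_apply', Function.iterate_succ_apply', familyD_apply, ih]
  simp only [multiD, hr]

variable {s : ℝ} (hs : 0 ≤ s)

variable (S Ω) in
/-- Families of smooth functions, with Gevrey coefficients independent of the parameter, filtered
by the order with respect to a vector `V`. -/
def familyRing (V : Fin 7 → S → smoothRing Ω) : FilteredDiffRing (S → smoothRing Ω) :=
  .ofVec (familyD S Ω) (fun i j f => funext fun v => smoothD_comm i j (f v))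
    ((gevreyRing Ω hs).map (Pi.constRingHom S (smoothRing Ω)))
    (by
      rintro i _ ⟨g, hg, rfl⟩
      exact ⟨smoothD Ω i g, smoothD_mem_gevreyRing hs i hg, rfl⟩) V

lemma exists_coeff_of_mem {V : Fin 7 → S → smoothRing Ω} {m : ℕ} {f : S → smoothRing Ω}
    (hf : f ∈ (familyRing S Ω hs V).F m) :
    ∃ c : (Fin 3 → ℕ) → Fin 7 → smoothRing Ω, (∀ β j, c β j ∈ gevreyRing Ω hs) ∧
      ∀ v, f v = ∑ β ∈ Finset.univ.filter
          (fun β : Fin 3 → Fin (m + 1) => mdeg (fun k => (β k : ℕ)) ≤ m),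
        ∑ j, c (fun k => β k) j * multiD (fun i => smoothD Ω i) (fun k => β k) (V j v) := by
  induction hf using Submodule.span_induction with
  | mem f hf =>
    obtain ⟨β, j, hβ, rfl⟩ := hf
    refine ⟨fun γ k => if γ = β ∧ k = j then 1 else 0, fun γ k => ?_, fun v => ?_⟩
    · dsimp only
      split_ifs
      exacts [one_mem _, zero_mem _]
    · have hlt (k : Fin 3) : β k < m + 1 := by
        unfold mdeg at hβ
        fin_cases k <;> simp <;> omega
      rw [Finset.sum_eq_single (fun k => ⟨β k, hlt k⟩), Finset.sum_eq_single j]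
      · simp only [and_self, if_true, one_mul]
        exact multiD_familyD_apply β (V j) v
      · intro k _ hk
        simp [hk]
      · simp
      · intro γ _ hγ
        refine Finset.sum_eq_zero fun k _ => ?_
        dsimp only
        rw [if_neg, zero_mul]
        rintro ⟨rfl, -⟩
        exact hγ rfl
      · intro h
        exact absurd hβ (by simpa using h)
  | zero => exact ⟨0, fun _ _ => zero_mem _, fun v => by simp⟩
  | add f g _ _ hf hg =>
    obtain ⟨c, hc, hf⟩ := hf
    obtain ⟨d, hd, hg⟩ := hg
    refine ⟨c + d, fun β j => add_mem (hc β j) (hd β j), fun v => ?_⟩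
    simp only [Pi.add_apply, hf, hg, add_mul, Finset.sum_add_distrib]
  | smul g f _ hf =>
    obtain ⟨_, g, hg, rfl⟩ := g
    obtain ⟨c, hc, hf⟩ := hf
    refine ⟨fun β j => g * c β j, fun β j => mul_mem hg (hc β j), fun v => ?_⟩
    change g * f v = _
    simp only [hf, Finset.mul_sum, mul_assoc]

end Families

section Transfer

variable {Ω : Opens E3}

lemma Represents.op2 {a : Fin 3 → Fin 3 → E3 → ℝ} {b : Fin 3 → Fin 3 → smoothRing Ω}
    (hab : ∀ j k, Represents (a j k) (b j k)) {F : E3 → ℝ} {f : smoothRing Ω}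
    (hF : Represents F f) :
    Represents (op2 a F) (∑ j, ∑ k, b j k * smoothD Ω j (smoothD Ω k f)) :=
  .sum fun j => .sum fun k => (hab j k).mul ((hF.pd k).pd j)

variable {t : Fin 3 → Fin 3 → E3 → ℝ} {lam mu : E3 → ℝ} {u : E3 → Fin 3 → ℝ}
  {t' : Fin 3 → Fin 3 → smoothRing Ω} {lam' mu' : smoothRing Ω} {u' : Fin 3 → smoothRing Ω}

lemma represents_a1coef (ht : ∀ j k, Represents (t j k) (t' j k)) (hmu : Represents mu mu')
    (j k : Fin 3) :
    Represents (a1coef t mu j k) (FilteredDiffRing.coef t' mu' j k) := fun x => by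
  unfold a1coef FilteredDiffRing.coef
  split_ifs <;> simp [ht j k x, hmu x]

lemma represents_a2coef (ht : ∀ j k, Represents (t j k) (t' j k)) (hlam : Represents lam lam')
    (hmu : Represents mu mu') (j k : Fin 3) :
    Represents (a2coef t lam mu j k) (FilteredDiffRing.coef t' (mu' + (lam' + mu')) j k) :=
  fun x => by
    unfold a2coef FilteredDiffRing.coef
    split_ifs
    · simp [ht j k x, hmu x, hlam x]
      ring
    · simp [ht j k x]

lemma represents_Ufull (hu : ∀ i, Represents (fun x => u x i) (u' i)) (j : Fin 7) :
    Represents (fun x => Ufull u x j) (FilteredDiffRing.fullVec (smoothD Ω) u' j) := by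
  fin_cases j
  · exact hu 0
  · exact hu 1
  · exact hu 2
  · exact Represents.sum (s := Finset.univ) fun k => (hu k).pd k
  · exact ((hu 2).pd 1).sub ((hu 1).pd 2)
  · exact ((hu 0).pd 2).sub ((hu 2).pd 0)
  · exact ((hu 1).pd 0).sub ((hu 0).pd 1)

lemma represents_stress (ht : ∀ j k, Represents (t j k) (t' j k)) (hlam : Represents lam lam')
    (hmu : Represents mu mu') (hu : ∀ i, Represents (fun x => u x i) (u' i)) (i j : Fin 3) :
    Represents (fun x => stress t lam mu u x i j)
      (t' i j + (∑ k, smoothD Ω k (u' i) * t' k j) +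
        lam' * (∑ k, smoothD Ω k (u' k)) * (if i = j then 1 else 0) +
        mu' * (smoothD Ω j (u' i) + smoothD Ω i (u' j))) := fun x => by
  simp only [stress, divg, strain, ht _ _ x, hlam x, hmu x, (hu _).pd _ x]
  split_ifs <;> simp <;> ring

end Transfer

/-- **Reduction to a fourth-order principally diagonal system** (equation
(2.13)).  With Gevrey `G^s` coefficients, there exist `7×7`-matrix-valued
coefficients `a_β ∈ G^s(Ω)`, `|β| ≤ 3`, depending only on `λ, μ, ρ, T, κ`, such
that for every smooth solution `u` of the residual stress system,
`U = (u, ∇·u, ∇×u)` satisfies `P₂P₁U = Σ_{|β|≤3} a_β ∂^β U` in `Ω`. -/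
theorem reduction_to_fourth_order
    (Ω : Set E3) (hΩopen : IsOpen Ω) (hΩconn : IsConnected Ω)
    (s κ : ℝ) (hs : 1 ≤ s)
    (t : Fin 3 → Fin 3 → E3 → ℝ) (lam mu rho : E3 → ℝ)
    (htsym : ∀ j k : Fin 3, ∀ x ∈ Ω, t j k x = t k j x)
    (hdivT : ∀ x ∈ Ω, ∀ i : Fin 3, (∑ j, pd j (t i j) x) = 0)
    (hrho : ∀ x ∈ Ω, 0 < rho x)
    (hGt : ∀ j k : Fin 3, GevreyOn s Ω (t j k))
    (hGlam : GevreyOn s Ω lam) (hGmu : GevreyOn s Ω mu) (hGrho : GevreyOn s Ω rho)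
    (hell1 : UnifElliptic (a1coef t mu) Ω) (hell2 : UnifElliptic (a2coef t lam mu) Ω) :
    ∃ aβ : (Fin 3 → ℕ) → E3 → Fin 7 → Fin 7 → ℝ,
      (∀ β : Fin 3 → ℕ, mdeg β ≤ 3 → ∀ i j : Fin 7, GevreyOn s Ω (fun x => aβ β x i j)) ∧
      ∀ u : E3 → Fin 3 → ℝ, (∀ i : Fin 3, ContDiffOn ℝ (⊤ : ℕ∞) (fun x => u x i) Ω) →
        ResSystem t lam mu rho κ u Ω →
        ∀ x ∈ Ω, ∀ i : Fin 7,
          op2 (a2coef t lam mu) (op2 (a1coef t mu) (fun y => Ufull u y i)) x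
            = lowOrd aβ (Ufull u) x i := by
  lift Ω to TopologicalSpace.Opens E3 using hΩopen
  have hs0 : 0 ≤ s := zero_le_one.trans hs
  let S := {u : E3 → Fin 3 → ℝ // (∀ i : Fin 3, ContDiffOn ℝ (⊤ : ℕ∞) (fun x => u x i) Ω) ∧
    ResSystem t lam mu rho κ u Ω}
  let ι : smoothRing Ω →+* (S → smoothRing Ω) := Pi.constRingHom S (smoothRing Ω)
  let t' (j k : Fin 3) : smoothRing Ω := restr (t j k) (hGt j k).1
  have ht (j k : Fin 3) : Represents (t j k) (t' j k) := represents_restr _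
  let lam' : smoothRing Ω := restr lam hGlam.1
  have hlam : Represents lam lam' := represents_restr _
  let mu' : smoothRing Ω := restr mu hGmu.1
  have hmu : Represents mu mu' := represents_restr _
  have hκ : Represents (fun _ => κ ^ 2) (restr (fun _ => κ ^ 2) contDiffOn_const : smoothRing Ω) :=
    represents_restr _
  let q' : smoothRing Ω := restr (fun _ => κ ^ 2) contDiffOn_const * restr rho hGrho.1
  have hq : Represents (fun x => κ ^ 2 * rho x) q' := hκ.mul (represents_restr hGrho.1)
  let u' (i : Fin 3) (v : S) : smoothRing Ω := restr (fun x => v.1 x i) (v.2.1 i)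
  have hu (i : Fin 3) (v : S) : Represents (fun x => v.1 x i) (u' i v) := represents_restr _
  let V := FilteredDiffRing.fullVec (familyD S Ω) u'
  let X := familyRing S Ω hs0 V
  have hV (j : Fin 7) (v : S) : Represents (fun x => Ufull v.1 x j) (V j v) := by
    convert! represents_Ufull (fun i => hu i v) j using 1
    fin_cases j <;> rfl
  have hX : X.Solves (fun j k => ι (t' j k)) (ι lam') (ι mu') (ι q') u' := by
    constructor
    · intro i
      funext v
      rw [Finset.sum_apply]
      refine (Represents.sum (s := Finset.univ) fun j => (ht i j).pd j).ext fun x => ?_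
      exact hdivT x x.2 i
    · intro i
      funext v
      have := (Represents.sum (s := Finset.univ) fun j =>
        (represents_stress ht hlam hmu (fun i => hu i v) i j).pd j).add (hq.mul (hu i v))
      refine Eq.trans ?_ (this.ext fun x => v.2.2 x x.2 i)
      rw [Pi.add_apply, Finset.sum_apply]
      refine congrArg₂ (· + ·) (Finset.sum_congr rfl fun j _ => congrArg (smoothD Ω j) ?_) rfl
      simp only [Pi.add_apply, Pi.mul_apply, Finset.sum_apply]
      split_ifs <;> rfl
  have hmem {F : E3 → ℝ} {f : smoothRing Ω} (hF : Represents F f) (hG : GevreyOn s Ω F) :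
      ι f ∈ X.G := ⟨f, (hF.gevreyOn_iff hs0).1 hG, rfl⟩
  have hadm := hX.admissible (fun j k => hmem (ht j k) (hGt j k)) (hmem hlam hGlam)
    (hmem hmu hGmu) (by
      rw [map_mul]
      exact mul_mem ⟨_, ⟨_, by positivity, _, one_pos, hκ.derivBound s⟩, rfl⟩
        (hmem (represents_restr hGrho.1) hGrho))
    (fun j => Submodule.subset_span ⟨0, j, le_rfl, rfl⟩)
  choose c hc hcV using fun j => exists_coeff_of_mem hs0 (hadm.op_op_fullVec j)
  refine ⟨fun β x i j => zext (c i β j).1 x, fun β _ i j =>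
    ((represents_zext _).gevreyOn_iff hs0).2 (hc i β j), fun u hu1 hu2 x hx i => ?_⟩
  have hP := Represents.op2 (represents_a2coef ht hlam hmu)
    (Represents.op2 (represents_a1coef ht hmu) (hV i ⟨u, hu1, hu2⟩))
  refine (hP ⟨x, hx⟩).trans (Eq.trans ?_ ((Represents.sum fun β => Represents.sum fun j =>
    (represents_zext (c i _ j)).mul ((hV j ⟨u, hu1, hu2⟩).mpd _)) ⟨x, hx⟩).symm)
  refine congrArg (fun f : smoothRing Ω => f.1 ⟨x, hx⟩) (Eq.trans ?_ (hcV i ⟨u, hu1, hu2⟩))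
  rfl
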